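/- arXiv:1712.01227 — 3 statements merged into one kernel-verified Lean document; each statement's English description precedes it below -/
import Mathlib

section
/- Let (X,d) be a complete separable metric space, T ⊆ X, and D ⊆ X a countable dense subset. Let 0 < α < α' < 1 and 0 < β' < β < 1 with αβ = α'β'. If player II has a winning strategy in the rational Schmidt (α',β') game (with respect to D) with target set T, then player II has a winning strategy in Schmidt's (α,β) game with target set T. -/
open Filter Topology

/-- The history (the list of moves) of the first `n` moves of the run `f`. -/
def histOf {M : Type*} (f : ℕ → M) (n : ℕ) : List M := (List.range n).map f

/-- The axiom of determinacy `AD` for integer games: for every payoff set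
`A ⊆ ℕ^ℕ`, in the game where I plays `x (2k)` and II plays `x (2k+1)`, and I wins
iff `x ∈ A`, one of the players has a winning strategy. -/
def AD : Prop :=
  ∀ A : Set (ℕ → ℕ),
    (∃ σ : List ℕ → ℕ, ∀ x : ℕ → ℕ, (∀ k, x (2 * k) = σ (histOf x (2 * k))) → x ∈ A) ∨
    (∃ τ : List ℕ → ℕ, ∀ x : ℕ → ℕ, (∀ k, x (2 * k + 1) = τ (histOf x (2 * k + 1))) → x ∉ A)

/-- A specification of an infinite two-player game with moves in `M`:
`firstOK` constrains the first move, `moveOK` constrains every single move,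
`stepOK i` constrains consecutive moves (at indices `i`, `i+1`), and `payoffII`
is the winning condition for player II on rule-following runs. -/
structure GameSpec (M : Type*) where
  firstOK : M → Prop
  moveOK : M → Prop
  stepOK : ℕ → M → M → Prop
  payoffII : (ℕ → M) → Prop

namespace GameSpec

variable {M : Type*} (G : GameSpec M)

/-- The first `n` moves of the run `f` follow the rules. -/
def LegalUpTo (f : ℕ → M) (n : ℕ) : Prop :=
  (0 < n → G.firstOK (f 0)) ∧ (∀ i < n, G.moveOK (f i)) ∧
    ∀ i, i + 1 < n → G.stepOK i (f i) (f (i + 1))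

/-- The whole run `f` follows the rules. -/
def Legal (f : ℕ → M) : Prop :=
  G.firstOK (f 0) ∧ (∀ i, G.moveOK (f i)) ∧ ∀ i, G.stepOK i (f i) (f (i + 1))

/-- A finite position (a finite sequence of moves) follows the rules. -/
def ListLegal (p : List M) : Prop :=
  ∃ f : ℕ → M, histOf f p.length = p ∧ G.LegalUpTo f p.length

/-- Player I (who makes the even-indexed moves) follows strategy `σ` in the run `f`. -/
def FollowsI (σ : List M → M) (f : ℕ → M) : Prop :=
  ∀ k, f (2 * k) = σ (histOf f (2 * k))

/-- Player II (who makes the odd-indexed moves) follows strategy `τ` in the run `f`. -/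
def FollowsII (τ : List M → M) (f : ℕ → M) : Prop :=
  ∀ k, f (2 * k + 1) = τ (histOf f (2 * k + 1))

/-- `σ` is a winning strategy for player I: whenever player I follows `σ`, player I
never violates the rules first, and if the whole run follows the rules then the run
is won by player I (i.e. it does not satisfy player II's payoff condition). -/
def WinningI (σ : List M → M) : Prop :=
  ∀ f : ℕ → M, FollowsI σ f →
    (∀ n, G.LegalUpTo f (2 * n) → G.LegalUpTo f (2 * n + 1)) ∧
      (G.Legal f → ¬ G.payoffII f)

/-- `τ` is a winning strategy for player II: whenever player II follows `τ`, player II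
never violates the rules first, and if the whole run follows the rules then the run
satisfies player II's payoff condition. -/
def WinningII (τ : List M → M) : Prop :=
  ∀ f : ℕ → M, FollowsII τ f →
    (∀ n, G.LegalUpTo f (2 * n + 1) → G.LegalUpTo f (2 * n + 2)) ∧
      (G.Legal f → G.payoffII f)

/-- The game is determined: one of the two players has a winning strategy. -/
def Determined : Prop := (∃ σ, G.WinningI σ) ∨ (∃ τ, G.WinningII τ)

end GameSpec

/-- Schmidt's `(α, β)` game on the metric space `X` with target set `T`.
Moves are pairs `(center, radius)`; the first radius must be positive, each ball
must be contained in the previous one (`ρ_{i+1} + d(x_i, x_{i+1}) ≤ ρ_i`), radii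
shrink by `α` after an even-indexed (player I) move and by `β` after an
odd-indexed (player II) move.  Player II wins a rule-following run iff the unique
point of intersection of the balls (the limit of the centers) lies in `T`. -/
def schmidtGame {X : Type*} [MetricSpace X] (α β : ℝ) (T : Set X) :
    GameSpec (X × ℝ) where
  firstOK m := 0 < m.2
  moveOK _ := True
  stepOK i prev next :=
    next.2 + dist prev.1 next.1 ≤ prev.2 ∧ next.2 = (if Even i then α else β) * prev.2
  payoffII f := ∃ z ∈ T, Tendsto (fun n => (f n).1) atTop (𝓝 z)

/-- Schmidt's `(α, β, ρ)` game: like the `(α, β)` game but the first radius must be `ρ`. -/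
def schmidtGameFixed {X : Type*} [MetricSpace X] (α β ρ : ℝ) (T : Set X) :
    GameSpec (X × ℝ) :=
  { schmidtGame α β T with firstOK := fun m => m.2 = ρ }

/-- The set of radii allowed in the rational Schmidt game: positive rational
multiples of `α^n * β^m`. -/
def ratRadii (α β : ℝ) : Set ℝ :=
  {r | ∃ (n m : ℕ) (q : ℚ), 0 < q ∧ r = α ^ n * β ^ m * (q : ℝ)}

/-- The rational Schmidt `(α, β)` game with respect to a countable dense set `D`:
Schmidt's `(α, β)` game where moreover every move `(x, ρ)` must have `x ∈ D` and
`ρ ∈ ⋃_{n,m} α^n β^m ℚ_{>0}`. -/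
def rationalSchmidtGame {X : Type*} [MetricSpace X] (α β : ℝ) (D : Set X) (T : Set X) :
    GameSpec (X × ℝ) :=
  { schmidtGame α β T with moveOK := fun m => m.1 ∈ D ∧ m.2 ∈ ratRadii α β }


namespace GameSpec

variable {M : Type*}

theorem LegalUpTo.mono {G : GameSpec M} {f : ℕ → M} {m n : ℕ} (h : G.LegalUpTo f n)
    (hmn : m ≤ n) : G.LegalUpTo f m :=
  ⟨fun hm => h.1 (hm.trans_le hmn), fun i hi => h.2.1 i (hi.trans_le hmn),
    fun i hi => h.2.2 i (hi.trans_le hmn)⟩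

theorem LegalUpTo.succ {G : GameSpec M} {f : ℕ → M} {n : ℕ} (h : G.LegalUpTo f (n + 1))
    (hm : G.moveOK (f (n + 1))) (hs : G.stepOK n (f n) (f (n + 1))) :
    G.LegalUpTo f (n + 2) := by
  refine ⟨fun _ => h.1 n.succ_pos, fun i hi => ?_, fun i hi => ?_⟩
  · rcases Nat.lt_succ_iff_lt_or_eq.1 hi with hi | rfl
    · exact h.2.1 i hi
    · exact hm
  · rcases Nat.lt_succ_iff_lt_or_eq.1 hi with hi | hi
    · exact h.2.2 i hi
    · obtain rfl : i = n := by omega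
      exact hs

theorem Legal.legalUpTo {G : GameSpec M} {f : ℕ → M} (h : G.Legal f) (n : ℕ) :
    G.LegalUpTo f n :=
  ⟨fun _ => h.1, fun i _ => h.2.1 i, fun i _ => h.2.2 i⟩

theorem legal_of_forall_legalUpTo {G : GameSpec M} {f : ℕ → M}
    (h : ∀ n, G.LegalUpTo f (2 * n + 1)) : G.Legal f :=
  ⟨(h 0).1 Nat.one_pos, fun i => (h i).2.1 i (by omega),
    fun i => (h (i + 1)).2.2 i (by omega)⟩

end GameSpec

section Responses

variable {M : Type*}

/-- The first `n` moves of the run in which I plays the sequence `a` and II follows `τ`. -/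
def responseHist (τ : List M → M) (a : ℕ → M) : ℕ → List M
  | 0 => []
  | n + 1 => responseHist τ a n ++ [if Even n then a (n / 2) else τ (responseHist τ a n)]

/-- The run in which I plays the sequence `a` and II follows `τ`. -/
def responseRun (τ : List M → M) (a : ℕ → M) (n : ℕ) : M :=
  if Even n then a (n / 2) else τ (responseHist τ a n)

theorem histOf_responseRun (τ : List M → M) (a : ℕ → M) (n : ℕ) :
    histOf (responseRun τ a) n = responseHist τ a n := by
  induction n with
  | zero => rfl
  | succ n ih =>
    rw [histOf, List.range_succ, List.map_append, ← histOf, ih]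
    rfl

theorem followsII_responseRun (τ : List M → M) (a : ℕ → M) :
    GameSpec.FollowsII τ (responseRun τ a) := by
  intro k
  rw [histOf_responseRun, responseRun, if_neg (by simp)]

theorem responseRun_even (τ : List M → M) (a : ℕ → M) (k : ℕ) :
    responseRun τ a (2 * k) = a k := by
  rw [responseRun, if_pos (by simp), Nat.mul_div_cancel_left _ two_pos]

theorem responseHist_congr (τ : List M → M) {a b : ℕ → M} {n : ℕ}
    (h : ∀ k, 2 * k < n → a k = b k) : responseHist τ a n = responseHist τ b n := by
  induction n with
  | zero => rfl
  | succ n ih =>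
    rw [responseHist, responseHist, ih fun k hk => h k (hk.trans n.lt_succ_self)]
    by_cases hn : Even n
    · rw [if_pos hn, if_pos hn, h (n / 2) (by omega)]
    · rw [if_neg hn, if_neg hn]

theorem responseRun_odd_congr (τ : List M → M) {a b : ℕ → M} {n : ℕ}
    (h : ∀ k ≤ n, a k = b k) :
    responseRun τ a (2 * n + 1) = responseRun τ b (2 * n + 1) := by
  rw [responseRun, responseRun, if_neg (by simp), if_neg (by simp),
    responseHist_congr τ fun k hk => h k (by omega)]

theorem length_histOf (f : ℕ → M) (n : ℕ) : (histOf f n).length = n := by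
  simp [histOf]

theorem getD_histOf (f : ℕ → M) {n i : ℕ} (hi : i < n) (d : M) :
    (histOf f n).getD i d = f i := by
  simp [histOf, List.getD, hi]

end Responses

theorem radius_even_of_legalUpTo {X : Type*} [MetricSpace X] {α β : ℝ} {T : Set X}
    {f : ℕ → X × ℝ} {n : ℕ} (h : (schmidtGame α β T).LegalUpTo f (2 * n + 1)) :
    (f (2 * n)).2 = (α * β) ^ n * (f 0).2 := by
  induction n with
  | zero => simp
  | succ n ih =>
    have e1 := (h.2.2 (2 * n) (by omega)).2
    have e2 := (h.2.2 (2 * n + 1) (by omega)).2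
    rw [if_pos (by simp)] at e1
    rw [if_neg (by simp)] at e2
    rw [show 2 * (n + 1) = 2 * n + 1 + 1 by ring, e2, e1, ih (h.mono (by omega))]
    ring

/-- If `0 < α < α' < 1`, `0 < β' < β < 1`, `αβ = α'β'`, and player II has a winning
strategy in the rational Schmidt `(α', β')` game (w.r.t. a countable dense `D`) with
target set `T`, then player II has a winning strategy in Schmidt's `(α, β)` game
with target set `T`. -/
theorem winningII_of_rational_winningII {X : Type*} [MetricSpace X] [CompleteSpace X]
    [TopologicalSpace.SeparableSpace X]
    (T D : Set X) (hDc : D.Countable) (hDd : Dense D)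
    (α α' β β' : ℝ) (h1 : 0 < α) (h2 : α < α') (h3 : α' < 1)
    (h4 : 0 < β') (h5 : β' < β) (h6 : β < 1) (hp : α * β = α' * β')
    (h : ∃ τ, (rationalSchmidtGame α' β' D T).WinningII τ) :
    ∃ τ, (schmidtGame α β T).WinningII τ := by
  obtain ⟨τ, hτ⟩ := h
  have hβ : 0 < β := h4.trans h5
  have hα' : 0 < α' := h1.trans h2
  have hP : 0 < α * β := mul_pos h1 hβ
  have hP1 : α * β < 1 := by nlinarith
  have hPα : α * β < α := by nlinarith
  -- the loss in the centers is at most `ε` times the radius, that in the radii a factor `c`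
  obtain ⟨ε, hε⟩ : ∃ ε, ε = (α' - α) / 2 := ⟨_, rfl⟩
  have hε0 : 0 < ε := by linarith
  obtain ⟨c, hc0, hc1, hc⟩ : ∃ c : ℝ, 0 < c ∧ c < 1 ∧
      α - α * β + ε ≤ (α' - α * β) * c := by
    have hpos : 0 < α' - α * β := by linarith
    refine ⟨(α - α * β + ε) / (α' - α * β), div_pos (by linarith) hpos, ?_, ?_⟩
    · rw [div_lt_one hpos]; linarith
    · rw [mul_div_cancel₀ _ hpos.ne']
  have hnear : ∀ (x : X) (δ : ℝ), ∃ y, 0 < δ → y ∈ D ∧ dist x y < δ := by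
    intro x δ
    by_cases hδ : 0 < δ
    · obtain ⟨y, hy, hxy⟩ := hDd.exists_dist_lt x hδ
      exact ⟨y, fun _ => ⟨hy, hxy⟩⟩
    · exact ⟨x, fun hh => absurd hh hδ⟩
  choose near hnear using hnear
  have hrat : ∀ r : ℝ, ∃ q : ℚ, 0 < r → c * r < q ∧ (q : ℝ) < r := by
    intro r
    by_cases hr : 0 < r
    · obtain ⟨q, hq⟩ := exists_rat_btwn (show c * r < r by nlinarith)
      exact ⟨q, fun _ => hq⟩
    · exact ⟨0, fun hh => absurd hh hr⟩
  choose rat hrat using hrat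
  let A : ℕ → X × ℝ → X × ℝ → X × ℝ := fun k m₀ m =>
    (near m.1 (ε * m.2), (α' * β') ^ k * (rat m₀.2 : ℝ))
  let d : X × ℝ := τ []
  refine ⟨fun L => ((responseRun τ
    (fun k => A k (L.getD 0 d) (L.getD (2 * k) d)) L.length).1,
      α * (L.getD (L.length - 1) d).2), fun f hf => ?_⟩
  obtain ⟨v, hv⟩ : ∃ v, v = responseRun τ (fun k => A k (f 0) (f (2 * k))) := ⟨_, rfl⟩
  have hvτ : GameSpec.FollowsII τ v := hv ▸ followsII_responseRun τ _
  have hve1 : ∀ n, (v (2 * n)).1 = near (f (2 * n)).1 (ε * (f (2 * n)).2) := fun n => by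
    rw [hv, responseRun_even]
  have hve2 : ∀ n, (v (2 * n)).2 = (α * β) ^ n * (rat (f 0).2 : ℝ) := fun n => by
    rw [hv, responseRun_even, hp]
  have hfo : ∀ n, f (2 * n + 1) = ((v (2 * n + 1)).1, α * (f (2 * n)).2) := by
    intro n
    rw [hf n]
    simp only [length_histOf]
    rw [Nat.add_sub_cancel, getD_histOf f (i := 2 * n) (by omega),
      getD_histOf f (i := 0) (by omega), hv]
    refine congrArg (fun w : X × ℝ => (w.1, α * (f (2 * n)).2))
      (responseRun_odd_congr τ fun k hk => ?_)
    rw [getD_histOf f (by omega)]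
  obtain ⟨hτlegal, hτwin⟩ := hτ v hvτ
  have hpos : ∀ n, (schmidtGame α β T).LegalUpTo f (2 * n + 1) → 0 < (f (2 * n)).2 := by
    intro n hn
    rw [radius_even_of_legalUpTo hn]
    exact mul_pos (pow_pos hP n) (hn.1 (by omega))
  have hq : ∀ n, (schmidtGame α β T).LegalUpTo f (2 * n + 1) →
      c * (f (2 * n)).2 < (v (2 * n)).2 ∧ (v (2 * n)).2 < (f (2 * n)).2 := by
    intro n hn
    rw [radius_even_of_legalUpTo hn, hve2]
    obtain ⟨ha, hb⟩ := hrat _ (hn.1 (by omega))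
    have hPn := pow_pos hP n
    exact ⟨by nlinarith, by nlinarith⟩
  have hD : ∀ n, (schmidtGame α β T).LegalUpTo f (2 * n + 1) →
      (v (2 * n)).1 ∈ D ∧ dist (f (2 * n)).1 (v (2 * n)).1 < ε * (f (2 * n)).2 := by
    intro n hn
    rw [hve1]
    exact hnear _ _ (mul_pos hε0 (hpos n hn))
  have hmove : ∀ n, (schmidtGame α β T).LegalUpTo f (2 * n + 1) →
      (rationalSchmidtGame α' β' D T).moveOK (v (2 * n)) := by
    intro n hn
    obtain ⟨ha, -⟩ := hrat _ (hn.1 (by omega))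
    have h0 : 0 < (f 0).2 := hn.1 (by omega)
    refine ⟨(hD n hn).1, n, n, rat (f 0).2, ?_, ?_⟩
    · exact_mod_cast (mul_pos hc0 h0).trans ha
    · rw [hve2, hp, mul_pow]
  have hvlegal : ∀ n, (schmidtGame α β T).LegalUpTo f (2 * n + 1) →
      (rationalSchmidtGame α' β' D T).LegalUpTo v (2 * n + 1) := by
    intro n
    induction n with
    | zero =>
      intro hn
      refine ⟨fun _ => ?_, fun i hi => ?_, fun i hi => by omega⟩
      · exact (mul_pos hc0 (hpos 0 hn)).trans (hq 0 hn).1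
      · obtain rfl : i = 0 := by omega
        exact hmove 0 hn
    | succ n ih =>
      intro hn
      have hn' := hn.mono (m := 2 * n + 1) (by omega)
      have hl := hτlegal n (ih hn')
      refine hl.succ (hmove (n + 1) hn) ?_
      have s0 := (hl.2.2 (2 * n) (by omega)).2
      obtain ⟨s1, s2⟩ := hn.2.2 (2 * n + 1) (by omega)
      rw [if_pos (by simp)] at s0
      rw [if_neg (by simp)] at s2
      have e1 := hfo n
      have r := hve2 (n + 1)
      rw [pow_succ, mul_right_comm, ← hve2 n] at r
      obtain ⟨hq1, hq2⟩ := hq n hn'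
      have hd := (hD (n + 1) hn).2
      have hp0 := hpos n hn'
      rw [show 2 * (n + 1) = 2 * n + 1 + 1 by ring] at hd r
      rw [e1] at s1 s2
      simp only at s1 s2
      refine ⟨?_, ?_⟩
      · have tri := dist_triangle (v (2 * n + 1)).1 (f (2 * n + 1 + 1)).1
          (v (2 * n + 1 + 1)).1
        rw [s0, r]
        rw [s2] at s1 hd
        have k1 := mul_lt_mul_of_pos_left hq1 (show 0 < α' - α * β by linarith)
        have k2 := mul_le_mul_of_nonneg_right hc hp0.le
        have k3 : ε * (β * (α * (f (2 * n)).2)) ≤ ε * (f (2 * n)).2 := by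
          refine mul_le_mul_of_nonneg_left ?_ hε0.le
          nlinarith
        linarith
      · rw [if_neg (by simp), r, s0, hp]
        ring
  refine ⟨fun n hn => ?_, fun hl => ?_⟩
  · refine hn.succ trivial ?_
    have s := (hτlegal n (hvlegal n hn)).2.2 (2 * n) (by omega)
    obtain ⟨s1, s2⟩ := s
    rw [if_pos (by simp)] at s2
    obtain ⟨hq1, hq2⟩ := hq n hn
    have hd := (hD n hn).2
    refine ⟨?_, ?_⟩
    · rw [hfo n]
      have tri := dist_triangle (f (2 * n)).1 (v (2 * n)).1 (v (2 * n + 1)).1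
      simp only
      rw [s2] at s1
      have k1 := mul_lt_mul_of_pos_left hq2 (show 0 < 1 - α' by linarith)
      have k2 : ε * (f (2 * n)).2 ≤ (α' - α) * (f (2 * n)).2 :=
        mul_le_mul_of_nonneg_right (by linarith) (hpos n hn).le
      linarith
    · rw [hfo n, if_pos (by simp)]
  · have hlu := fun n => hl.legalUpTo (2 * n + 1)
    obtain ⟨z, hz, hlim⟩ := hτwin
      (GameSpec.legal_of_forall_legalUpTo fun n => hvlegal n (hlu n))
    refine ⟨z, hz, ?_⟩
    have hbound : Tendsto (fun n => ε * ((α * β) ^ (n / 2) * (f 0).2)) atTop (𝓝 0) := by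
      have := ((tendsto_pow_atTop_nhds_zero_of_lt_one hP.le hP1).comp
        (Nat.tendsto_div_const_atTop two_ne_zero)).mul_const (f 0).2 |>.const_mul ε
      simpa using this
    have h0 : 0 < (f 0).2 := hl.1
    refine (tendsto_iff_of_dist (squeeze_zero (fun _ => dist_nonneg) (fun n => ?_)
      hbound)).2 hlim
    rcases Nat.even_or_odd' n with ⟨k, rfl | rfl⟩
    · rw [Nat.mul_div_cancel_left _ two_pos, ← radius_even_of_legalUpTo (hlu k)]
      exact (hD k (hlu k)).2.le
    · rw [hfo k, dist_self]
      positivity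
end

section
/- Let α, β ∈ (0,1) with α(2−β) < 1, let ρ > 0, and set r = ρ − 2ρα(1−β)·∑_{n=0}^∞ (αβ)^n = ρ(1 − 2α(1−β)/(1−αβ)) > 0. Let R ⊆ ℝ × [0,2π) satisfy ∀x ∈ ℝ ∃θ ∈ [0,2π) (x,θ) ∈ R, and let T = {(x, r·cos θ, r·sin θ) : (x,θ) ∈ R} ∪ {(x,y,z) ∈ ℝ³ : √(y²+z²) > r}. Then player I has no winning strategy in Schmidt's (α,β,ρ) game on ℝ³ (with the Euclidean metric) with target set T. -/
open Filter Topology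

/-- The point `(a, b, c)` of `ℝ³` (with the Euclidean metric). -/
noncomputable def pt3 (a b c : ℝ) : EuclideanSpace ℝ (Fin 3) :=
  (WithLp.equiv 2 (Fin 3 → ℝ)).symm ![a, b, c]

/-- The target set coding the relation `R ⊆ ℝ × [0, 2π)` along the cylinder of
radius `r` around the `x`-axis: the points `(x, r cos θ, r sin θ)` for `(x, θ) ∈ R`,
together with all points at distance `> r` from the `x`-axis. -/
def cylinderTarget (r : ℝ) (R : Set (ℝ × ℝ)) : Set (EuclideanSpace ℝ (Fin 3)) :=
  {p | ∃ x θ : ℝ, θ ∈ Set.Ico (0 : ℝ) (2 * Real.pi) ∧ (x, θ) ∈ R ∧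
      p = pt3 x (r * Real.cos θ) (r * Real.sin θ)} ∪
    {p | r < Real.sqrt ((p 1) ^ 2 + (p 2) ^ 2)}

/-- The history of the run in which I follows `σ` and II follows `τ`. -/
def playHist {M : Type*} (σ τ : List M → M) : ℕ → List M
  | 0 => []
  | n + 1 => playHist σ τ n ++ [if Even n then σ (playHist σ τ n) else τ (playHist σ τ n)]

theorem histOf_succ {M : Type*} (f : ℕ → M) (n : ℕ) : histOf f (n + 1) = histOf f n ++ [f n] := by
  simp [histOf, List.range_succ]

theorem exists_followsI_followsII {M : Type*} (σ τ : List M → M) :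
    ∃ f : ℕ → M, GameSpec.FollowsI σ f ∧ GameSpec.FollowsII τ f := by
  let f : ℕ → M := fun n => if Even n then σ (playHist σ τ n) else τ (playHist σ τ n)
  have hist : ∀ n, histOf f n = playHist σ τ n := by
    intro n
    induction n with
    | zero => rfl
    | succ n ih => rw [histOf_succ, ih, playHist]
  refine ⟨f, fun k => ?_, fun k => ?_⟩
  · rw [hist]; simp [f]
  · rw [hist]; simp [f]

/-- Player II's strategy of always pushing the centre as far as allowed in direction `u`. -/
def pushStrategy {E : Type*} [AddCommGroup E] [Module ℝ E] (α : ℝ) (u : E)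
    (l : List (E × ℝ)) : E × ℝ :=
  let p := l.getLastD (0, 0)
  (p.1 + ((1 - α) * p.2) • u, α * p.2)

theorem followsII_pushStrategy_apply {E : Type*} [AddCommGroup E] [Module ℝ E] {α : ℝ} {u : E}
    {f : ℕ → E × ℝ} (hf : GameSpec.FollowsII (pushStrategy α u) f) (k : ℕ) :
    f (2 * k + 1) = ((f (2 * k)).1 + ((1 - α) * (f (2 * k)).2) • u, α * (f (2 * k)).2) := by
  rw [hf k, histOf_succ]
  simp [pushStrategy, List.getLastD_eq_getLast?]

section SchmidtGame

variable {X : Type*} [MetricSpace X] {α β ρ : ℝ} {T : Set X} {f : ℕ → X × ℝ}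

theorem radius_pos_of_legalUpTo (hα : 0 < α) (hβ : 0 < β) (hρ : 0 < ρ) {n : ℕ}
    (hf : (schmidtGameFixed α β ρ T).LegalUpTo f n) {i : ℕ} (hi : i < n) : 0 < (f i).2 := by
  induction i with
  | zero =>
    have h : (f 0).2 = ρ := hf.1 hi
    rwa [h]
  | succ i ih =>
    rw [(hf.2.2 i hi).2]
    have := ih (by omega)
    split_ifs <;> positivity

theorem radius_of_legal (hf : (schmidtGameFixed α β ρ T).Legal f) (k : ℕ) :
    (f (2 * k)).2 = ρ * (α * β) ^ k ∧ (f (2 * k + 1)).2 = α * (ρ * (α * β) ^ k) := by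
  have odd : ∀ k, (f (2 * k + 1)).2 = α * (f (2 * k)).2 := fun k => by
    simpa using (hf.2.2 (2 * k)).2
  have even : ∀ k, (f (2 * (k + 1))).2 = β * (f (2 * k + 1)).2 := fun k => by
    simpa [mul_add] using (hf.2.2 (2 * k + 1)).2
  have main : (f (2 * k)).2 = ρ * (α * β) ^ k := by
    induction k with
    | zero => simpa using (show (f 0).2 = ρ from hf.1)
    | succ k ih => rw [even, odd, ih]; ring
  exact ⟨main, by rw [odd, main]⟩

theorem exists_tendsto_center_of_legal [CompleteSpace X] (hα : α ∈ Set.Ioo (0 : ℝ) 1)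
    (hβ : β ∈ Set.Ioo (0 : ℝ) 1) (hρ : 0 < ρ) (hf : (schmidtGameFixed α β ρ T).Legal f) :
    ∃ z, Tendsto (fun n => (f n).1) atTop (𝓝 z) := by
  have pos : ∀ n, 0 < (f n).2 := fun n =>
    radius_pos_of_legalUpTo hα.1 hβ.1 hρ (T := T) (n := n + 1)
      ⟨fun _ => hf.1, fun i _ => hf.2.1 i, fun i _ => hf.2.2 i⟩ n.lt_succ_self
  have radius : ∀ n, (f n).2 ≤ ρ * max α β ^ n := by
    intro n
    induction n with
    | zero => simpa using (show (f 0).2 = ρ from hf.1).le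
    | succ n ih =>
      rw [(hf.2.2 n).2]
      calc _ ≤ max α β * (f n).2 := by
              gcongr
              · exact (pos n).le
              · split_ifs <;> simp
        _ ≤ max α β * (ρ * max α β ^ n) := by
              gcongr
              exact hα.1.le.trans (le_max_left _ _)
        _ = _ := by ring
  refine cauchySeq_tendsto_of_complete
    (cauchySeq_of_le_geometric (max α β) ρ (max_lt hα.2 hβ.2) fun n => ?_)
  have := (hf.2.2 n).1
  linarith [pos (n + 1), radius n]

end SchmidtGame

section Push

variable {E : Type*} [NormedAddCommGroup E] [NormedSpace ℝ E] {α β ρ : ℝ} {T : Set E}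
  {f : ℕ → E × ℝ} {u : E}

theorem legal_of_winningI_of_push (hα : α ∈ Set.Ioo (0 : ℝ) 1) (hβ : β ∈ Set.Ioo (0 : ℝ) 1)
    (hρ : 0 < ρ) (hu : ‖u‖ = 1) {σ : List (E × ℝ) → E × ℝ}
    (hσ : (schmidtGameFixed α β ρ T).WinningI σ) (hI : GameSpec.FollowsI σ f)
    (hII : GameSpec.FollowsII (pushStrategy α u) f) :
    (schmidtGameFixed α β ρ T).Legal f := by
  have upTo : ∀ n, (schmidtGameFixed α β ρ T).LegalUpTo f (2 * n) := by
    intro n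
    induction n with
    | zero => exact ⟨by simp, by simp, by simp⟩
    | succ n ih =>
      have h := (hσ f hI).1 n ih
      refine ⟨fun _ => h.1 (by omega), fun _ _ => trivial, fun i hi => ?_⟩
      rcases Nat.lt_or_ge (i + 1) (2 * n + 1) with hi' | hi'
      · exact h.2.2 i hi'
      · obtain rfl : i = 2 * n := by omega
        have pos := radius_pos_of_legalUpTo hα.1 hβ.1 hρ h (Nat.lt_succ_self (2 * n))
        have h0 : 0 ≤ (1 - α) * (f (2 * n)).2 := mul_nonneg (by linarith [hα.2]) pos.le
        refine ⟨?_, ?_⟩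
        · rw [followsII_pushStrategy_apply hII n, dist_self_add_right, norm_smul, hu,
            Real.norm_of_nonneg h0]
          linarith
        · rw [followsII_pushStrategy_apply hII n]
          simp
  exact ⟨(upTo 1).1 (by norm_num), fun _ => trivial, fun i => (upTo (i + 1)).2.2 i (by omega)⟩

theorem norm_limit_sub_le_of_push (hα : α ∈ Set.Ioo (0 : ℝ) 1) (hβ : β ∈ Set.Ioo (0 : ℝ) 1)
    (hf : (schmidtGameFixed α β ρ T).Legal f)
    (hII : GameSpec.FollowsII (pushStrategy α u) f) {z : E}
    (hz : Tendsto (fun n => (f n).1) atTop (𝓝 z)) :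
    ‖z - (f 0).1 - (ρ * (1 - α) / (1 - α * β)) • u‖ ≤ ρ * α * (1 - β) / (1 - α * β) := by
  have hlt : α * β < 1 := mul_lt_one_of_nonneg_of_lt_one_left hα.1.le hα.2 hβ.2.le
  have hne : 1 - α * β ≠ 0 := by linarith
  have bound : ∀ n : ℕ,
      ‖(f (2 * n)).1 - (f 0).1 - (ρ * (1 - α) / (1 - α * β) * (1 - (α * β) ^ n)) • u‖ ≤
        ρ * α * (1 - β) / (1 - α * β) * (1 - (α * β) ^ n) := by
    intro n
    induction n with
    | zero => simp
    | succ n ih =>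
      have hstep := (hf.2.2 (2 * n + 1)).1
      rw [show 2 * n + 1 + 1 = 2 * (n + 1) by ring, (radius_of_legal hf _).1,
        (radius_of_legal hf _).2, dist_comm, dist_eq_norm] at hstep
      have hpush := congrArg Prod.fst (followsII_pushStrategy_apply hII n)
      rw [(radius_of_legal hf n).1] at hpush
      simp only at hpush
      have split : (f (2 * (n + 1))).1 - (f 0).1 -
            (ρ * (1 - α) / (1 - α * β) * (1 - (α * β) ^ (n + 1))) • u =
          ((f (2 * n)).1 - (f 0).1 - (ρ * (1 - α) / (1 - α * β) * (1 - (α * β) ^ n)) • u) +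
            ((f (2 * (n + 1))).1 - (f (2 * n + 1)).1) := by
        rw [hpush, show ρ * (1 - α) / (1 - α * β) * (1 - (α * β) ^ (n + 1)) =
          ρ * (1 - α) / (1 - α * β) * (1 - (α * β) ^ n) + (1 - α) * (ρ * (α * β) ^ n) by
            field_simp; ring]
        module
      rw [split]
      refine (norm_add_le _ _).trans ?_
      rw [show ρ * α * (1 - β) / (1 - α * β) * (1 - (α * β) ^ (n + 1)) =
          ρ * α * (1 - β) / (1 - α * β) * (1 - (α * β) ^ n) +
            (α * (ρ * (α * β) ^ n) - ρ * (α * β) ^ (n + 1)) by field_simp; ring]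
      linarith
  have hpow : Tendsto (fun n : ℕ => 1 - (α * β) ^ n) atTop (𝓝 1) := by
    simpa using (tendsto_pow_atTop_nhds_zero_of_lt_one (mul_pos hα.1 hβ.1).le hlt).const_sub 1
  have hz2 : Tendsto (fun n => (f (2 * n)).1) atTop (𝓝 z) :=
    hz.comp (tendsto_id.const_mul_atTop' two_pos)
  have h := le_of_tendsto_of_tendsto'
    ((hz2.sub_const (f 0).1).sub ((hpow.const_mul _).smul_const u)).norm (hpow.const_mul _) bound
  simpa only [mul_one] using h

end Push

theorem norm_pt3 (a b c : ℝ) : ‖pt3 a b c‖ = Real.sqrt (a ^ 2 + b ^ 2 + c ^ 2) := by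
  simp [pt3, EuclideanSpace.norm_eq, Fin.sum_univ_three]

theorem mem_cylinderTarget_of_norm_le {r S t d θ : ℝ} {R : Set (ℝ × ℝ)}
    {x z : EuclideanSpace ℝ (Fin 3)} (hr : 0 < r) (hrS : r = S - t) (ht : 0 ≤ t) (hd : 0 ≤ d)
    (hx1 : x 1 = d * Real.cos θ) (hx2 : x 2 = d * Real.sin θ)
    (hθ : d = 0 → θ ∈ Set.Ico (0 : ℝ) (2 * Real.pi) ∧ (x 0, θ) ∈ R)
    (hz : ‖z - x - S • pt3 0 (Real.cos θ) (Real.sin θ)‖ ≤ t) : z ∈ cylinderTarget r R := by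
  have hcs := Real.sin_sq_add_cos_sq θ
  have hv : z - x - S • pt3 0 (Real.cos θ) (Real.sin θ) =
      pt3 (z 0 - x 0) (z 1 - (d + S) * Real.cos θ) (z 2 - (d + S) * Real.sin θ) := by
    ext i
    fin_cases i <;> simp [pt3, hx1, hx2] <;> ring
  rw [hv, norm_pt3, Real.sqrt_le_left ht] at hz
  by_cases hout : r < Real.sqrt (z 1 ^ 2 + z 2 ^ 2)
  · exact Or.inr hout
  rw [not_lt, Real.sqrt_le_left hr.le] at hout
  obtain ⟨m, hm⟩ : ∃ m, m = z 1 * Real.cos θ + z 2 * Real.sin θ := ⟨_, rfl⟩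
  obtain ⟨n, hn⟩ : ∃ n, n = z 2 * Real.cos θ - z 1 * Real.sin θ := ⟨_, rfl⟩
  have hz1 : z 1 = m * Real.cos θ - n * Real.sin θ := by
    rw [hm, hn]; linear_combination (-z 1) * hcs
  have hz2 : z 2 = m * Real.sin θ + n * Real.cos θ := by
    rw [hm, hn]; linear_combination (-z 2) * hcs
  have h1 : m ^ 2 + n ^ 2 ≤ r ^ 2 := by
    have : z 1 ^ 2 + z 2 ^ 2 = m ^ 2 + n ^ 2 := by
      rw [hz1, hz2]; linear_combination (m ^ 2 + n ^ 2) * hcs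
    linarith
  have h2 : (z 0 - x 0) ^ 2 + (m - (d + S)) ^ 2 + n ^ 2 ≤ t ^ 2 := by
    have : (z 1 - (d + S) * Real.cos θ) ^ 2 + (z 2 - (d + S) * Real.sin θ) ^ 2 =
        (m - (d + S)) ^ 2 + n ^ 2 := by
      rw [hz1, hz2]; linear_combination ((m - (d + S)) ^ 2 + n ^ 2) * hcs
    linarith
  have hmr : m ≤ r := abs_le_of_sq_le_sq' (by nlinarith [sq_nonneg n]) hr.le |>.2
  have hmt : -t ≤ m - (d + S) :=
    abs_le_of_sq_le_sq' (by nlinarith [sq_nonneg n, sq_nonneg (z 0 - x 0)]) ht |>.1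
  obtain rfl : d = 0 := by linarith
  obtain rfl : m = r := by linarith
  have hn0 : n = 0 := pow_eq_zero_iff two_ne_zero |>.1 (by nlinarith [sq_nonneg n])
  have hmS : m - (0 + S) = -t := by linarith
  rw [hmS, hn0] at h2
  have hz0 : z 0 - x 0 = 0 :=
    pow_eq_zero_iff two_ne_zero |>.1 (by nlinarith [sq_nonneg (z 0 - x 0)])
  refine Or.inl ⟨x 0, θ, (hθ rfl).1, (hθ rfl).2, ?_⟩
  ext i
  fin_cases i
  · simpa [pt3] using sub_eq_zero.1 hz0
  · simpa [pt3, hn0] using hz1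
  · simpa [pt3, hn0] using hz2

/-- Let `α, β ∈ (0,1)` with `α(2-β) < 1`, `ρ > 0`, and
`r = ρ(1 - 2α(1-β)/(1-αβ))`.  For any total relation `R ⊆ ℝ × [0, 2π)`, player I
has no winning strategy in Schmidt's `(α, β, ρ)` game on `ℝ³` with target set
`T = {(x, r cos θ, r sin θ) : (x, θ) ∈ R} ∪ {(x,y,z) : √(y²+z²) > r}`. -/
theorem playerI_no_winning_strategy_cylinder
    (α β ρ r : ℝ) (hα : α ∈ Set.Ioo (0 : ℝ) 1) (hβ : β ∈ Set.Ioo (0 : ℝ) 1)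
    (hαβ : α * (2 - β) < 1) (hρ : 0 < ρ)
    (hr : r = ρ * (1 - 2 * α * (1 - β) / (1 - α * β)))
    (R : Set (ℝ × ℝ)) (hR : ∀ x : ℝ, ∃ θ ∈ Set.Ico (0 : ℝ) (2 * Real.pi), (x, θ) ∈ R) :
    ¬ ∃ σ, (schmidtGameFixed α β ρ (cylinderTarget r R)).WinningI σ := by
  rintro ⟨σ, hσ⟩
  have hlt : 0 < 1 - α * β := by
    linarith [mul_lt_one_of_nonneg_of_lt_one_left hα.1.le hα.2 hβ.2.le]
  have ht : 0 ≤ ρ * α * (1 - β) / (1 - α * β) :=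
    div_nonneg (mul_nonneg (mul_pos hρ hα.1).le (by linarith [hβ.2])) hlt.le
  have hrS : r = ρ * (1 - α) / (1 - α * β) - ρ * α * (1 - β) / (1 - α * β) := by
    rw [hr]; field_simp; ring
  have hr0 : 0 < r := by
    rw [hrS, ← sub_div]
    refine div_pos ?_ hlt
    nlinarith [mul_pos hρ (sub_pos.2 hαβ)]
  obtain ⟨x, hx⟩ : ∃ x, x = (σ []).1 := ⟨_, rfl⟩
  obtain ⟨d, θ, hd, hx1, hx2, hθ⟩ : ∃ d θ : ℝ, 0 ≤ d ∧ x 1 = d * Real.cos θ ∧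
      x 2 = d * Real.sin θ ∧
      (d = 0 → θ ∈ Set.Ico (0 : ℝ) (2 * Real.pi) ∧ (x 0, θ) ∈ R) := by
    by_cases h : (⟨x 1, x 2⟩ : ℂ) = 0
    · obtain ⟨θ, hθ, hR'⟩ := hR (x 0)
      rw [Complex.ext_iff] at h
      exact ⟨0, θ, le_rfl, by simpa using h.1, by simpa using h.2, fun _ => ⟨hθ, hR'⟩⟩
    · exact ⟨_, _, norm_nonneg _, (Complex.norm_mul_cos_arg ⟨x 1, x 2⟩).symm,
        (Complex.norm_mul_sin_arg ⟨x 1, x 2⟩).symm, fun h' => absurd (norm_eq_zero.1 h') h⟩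
  obtain ⟨f, hI, hII⟩ :=
    exists_followsI_followsII σ (pushStrategy α (pt3 0 (Real.cos θ) (Real.sin θ)))
  have hf0 : (f 0).1 = x := by rw [hx]; exact congrArg Prod.fst (hI 0)
  have hlegal := legal_of_winningI_of_push hα hβ hρ (by simp [norm_pt3]) hσ hI hII
  obtain ⟨z, hz⟩ := exists_tendsto_center_of_legal hα hβ hρ hlegal
  have hle := norm_limit_sub_le_of_push hα hβ hlegal hII hz
  rw [hf0] at hle
  exact (hσ f hI).2 hlegal ⟨z, mem_cylinderTarget_of_norm_le hr0 hrS ht hd hx1 hx2 hθ hle, hz⟩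
end

section
/- Let 𝒞 be a collection of subsets of ℝ, each of which is a half-open interval of the form [z, z+ε) or (z−ε, z] for some z ∈ ℝ and ε > 0, such that ⋃𝒞 = ℝ. Then there is a countable subcollection 𝒞' ⊆ 𝒞 with ⋃𝒞' = ℝ. Moreover, the set ℝ \ ⋃_{I ∈ 𝒞} int(I) (where int(I) denotes the interior of I) is countable. -/
open Set Topology

/-- If every point `x` of a set `s` is an endpoint of a nonempty open interval disjoint from `s`,
then `s` is countable. -/
theorem Set.countable_of_forall_disjoint_Ioo {s : Set ℝ}
    (h : ∀ x ∈ s, ∃ ε > 0, Disjoint s (Ioo x (x + ε)) ∨ Disjoint s (Ioo (x - ε) x)) :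
    s.Countable := by
  refine (countable_setOfPred_isolated_right_within.union
    countable_setOfPred_isolated_left_within : ({x ∈ s | 𝓝[s ∩ Ioi x] x = ⊥} ∪
      {x ∈ s | 𝓝[s ∩ Iio x] x = ⊥}).Countable).mono fun x hx ↦ ?_
  obtain ⟨ε, hε, hd | hd⟩ := h x hx
  · refine Or.inl ⟨hx, Filter.empty_mem_iff_bot.mp ?_⟩
    refine mem_nhdsWithin.mpr ⟨Iio (x + ε), isOpen_Iio, by simpa using hε, ?_⟩
    exact fun y hy ↦ hd.le_bot ⟨hy.2.1, hy.2.2, hy.1⟩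
  · refine Or.inr ⟨hx, Filter.empty_mem_iff_bot.mp ?_⟩
    refine mem_nhdsWithin.mpr ⟨Ioi (x - ε), isOpen_Ioi, by simpa using hε, ?_⟩
    exact fun y hy ↦ hd.le_bot ⟨hy.2.1, hy.1, hy.2.2⟩

/-- The points not interior to any member of a cover of `ℝ` by half-open intervals form a
countable set. -/
theorem countable_compl_biUnion_interior_of_halfopen_cover {C : Set (Set ℝ)}
    (hC : ∀ I ∈ C, ∃ z ε : ℝ, 0 < ε ∧ (I = Ico z (z + ε) ∨ I = Ioc (z - ε) z))
    (hcov : ⋃₀ C = univ) : (univ \ ⋃ I ∈ C, interior I).Countable := by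
  refine Set.countable_of_forall_disjoint_Ioo fun x hx ↦ ?_
  obtain ⟨I, hI, hxI⟩ : x ∈ ⋃₀ C := hcov ▸ mem_univ x
  have hd : Disjoint (univ \ ⋃ I ∈ C, interior I) (interior I) :=
    disjoint_sdiff_left.mono_right (subset_biUnion_of_mem (u := interior) hI)
  have hxint : x ∉ interior I := fun h ↦ hd.le_bot ⟨hx, h⟩
  obtain ⟨z, ε, hε, rfl | rfl⟩ := hC I hI
  · rw [interior_Ico] at hd hxint
    obtain rfl : z = x := hxI.1.eq_of_not_lt fun h ↦ hxint ⟨h, hxI.2⟩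
    exact ⟨ε, hε, Or.inl hd⟩
  · rw [interior_Ioc] at hd hxint
    obtain rfl : x = z := hxI.2.eq_of_not_lt fun h ↦ hxint ⟨hxI.1, h⟩
    exact ⟨ε, hε, Or.inr hd⟩

/-- A cover has a countable subcover as soon as the points not interior to any of its members form
a countable set. -/
theorem exists_countable_subcover_of_countable_compl_biUnion_interior {X : Type*}
    [TopologicalSpace X] [SecondCountableTopology X] {C : Set (Set X)} (hcov : ⋃₀ C = univ)
    (h : (univ \ ⋃ I ∈ C, interior I).Countable) :
    ∃ C' ⊆ C, C'.Countable ∧ ⋃₀ C' = univ := by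
  obtain ⟨T, hTC, hT, hTU⟩ :=
    TopologicalSpace.isOpen_biUnion_countable C interior fun _ _ ↦ isOpen_interior
  have hmem (x : X) : ∃ I ∈ C, x ∈ I := mem_sUnion.mp (hcov ▸ mem_univ x)
  choose f hfC hf using hmem
  refine ⟨T ∪ f '' (univ \ ⋃ I ∈ C, interior I),
    union_subset hTC (image_subset_iff.mpr fun x _ ↦ hfC x), hT.union (h.image f),
    eq_univ_of_forall fun x ↦ ?_⟩
  by_cases hx : x ∈ ⋃ I ∈ C, interior I
  · rw [← hTU] at hx
    obtain ⟨I, hI, hxI⟩ := mem_iUnion₂.mp hx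
    exact ⟨I, Or.inl hI, interior_subset hxI⟩
  · exact ⟨f x, Or.inr (mem_image_of_mem f ⟨mem_univ x, hx⟩), hf x⟩

/-- If `𝒞` is a cover of `ℝ` by half-open intervals of the form `[z, z+ε)` or
`(z-ε, z]` (with `ε > 0`), then some countable subcollection `𝒞' ⊆ 𝒞` still covers
`ℝ`; moreover the set of points of `ℝ` not covered by the interiors of the members
of `𝒞` is countable. -/
theorem countable_subcover_of_halfopen_cover (C : Set (Set ℝ))
    (hC : ∀ I ∈ C, ∃ z ε : ℝ, 0 < ε ∧ (I = Set.Ico z (z + ε) ∨ I = Set.Ioc (z - ε) z))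
    (hcov : ⋃₀ C = Set.univ) :
    (∃ C' ⊆ C, C'.Countable ∧ ⋃₀ C' = Set.univ) ∧
      Set.Countable (Set.univ \ ⋃ I ∈ C, interior I) := by
  have h := countable_compl_biUnion_interior_of_halfopen_cover hC hcov
  exact ⟨exists_countable_subcover_of_countable_compl_biUnion_interior hcov h, h⟩
end
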